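/- Let 0 < α < 1/2. Suppose C assigns to each x ∈ ℝ a subset C(x) ⊆ ℝ such that the set {(x, θ) ∈ ℝ² : θ ∈ C(x)} is measurable, and suppose C is a 1 − α confidence procedure: for every θ ∈ ℝ, the N(θ,1) probability that θ ∈ C(X) is at least 1 − α. Then the expected Lebesgue measure of C(X) when X ~ N(0,1) is at least the expected length of Pratt's interval at θ = 0: ∫_ℝ λ(C(x)) φ(x) dx ≥ ∫_ℝ (max(0, x + z_α) − min(0, x − z_α)) φ(x) dx, where λ denotes Lebesgue measure. -/

import Mathlib

open Real Set MeasureTheory ProbabilityTheory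

/-- The standard normal density. -/
noncomputable def phi (x : ℝ) : ℝ := (Real.sqrt (2 * Real.pi))⁻¹ * Real.exp (-x ^ 2 / 2)

/-- The standard normal cumulative distribution function. -/
noncomputable def Phi (x : ℝ) : ℝ := ∫ t in Set.Iic x, phi t

/-- Neyman–Pearson: if `ν` is at most `k • μ` outside `B` and at least `k • μ` inside `B`, then `B`
minimises `μ` among the sets whose `ν`-measure is at least that of `B`. -/
lemma measure_le_of_likelihood_ratio {Ω : Type*} [MeasurableSpace Ω] {μ ν : Measure Ω}
    [IsFiniteMeasure ν] {k : ENNReal} (hk : k ≠ 0) (hk' : k ≠ ⊤) {A B : Set Ω}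
    (hA : MeasurableSet A) (hB : MeasurableSet B) (hout : ν (A \ B) ≤ k * μ (A \ B))
    (hin : k * μ (B \ A) ≤ ν (B \ A)) (h : ν B ≤ ν A) : μ B ≤ μ A := by
  have hν : ν (B \ A) ≤ ν (A \ B) := by
    rw [← measure_inter_add_sdiff B hA, ← measure_inter_add_sdiff A hB, inter_comm B A] at h
    exact (ENNReal.add_le_add_iff_left (measure_ne_top ν _)).1 h
  have hμ : μ (B \ A) ≤ μ (A \ B) :=
    (ENNReal.mul_le_mul_iff_right hk hk').1 (hin.trans (hν.trans hout))
  rw [← measure_inter_add_sdiff B hA, ← measure_inter_add_sdiff A hB, inter_comm B A]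
  gcongr

/-- The likelihood ratio of `N(θ,1)` against `N(0,1)` is `exp (θ x - θ² / 2)`. -/
lemma gaussianPDFReal_one_eq_exp_mul (θ x : ℝ) :
    gaussianPDFReal θ 1 x = exp (θ * x - θ ^ 2 / 2) * gaussianPDFReal 0 1 x := by
  simp only [gaussianPDFReal, NNReal.coe_one]
  rw [mul_left_comm, ← exp_add]
  congr 2
  ring

lemma gaussianReal_one_le_mul {θ c : ℝ} {S : Set ℝ} (hSm : MeasurableSet S)
    (hS : ∀ x ∈ S, θ * x ≤ θ * c) :
    gaussianReal θ 1 S ≤ ENNReal.ofReal (exp (θ * c - θ ^ 2 / 2)) * gaussianReal 0 1 S := by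
  rw [gaussianReal_apply _ one_ne_zero, gaussianReal_apply _ one_ne_zero,
    ← lintegral_const_mul _ (measurable_gaussianPDF 0 1)]
  refine setLIntegral_mono' hSm fun x hx ↦ ?_
  rw [gaussianPDF, gaussianPDF, ← ENNReal.ofReal_mul (exp_pos _).le,
    gaussianPDFReal_one_eq_exp_mul]
  have := hS x hx
  have := gaussianPDFReal_nonneg 0 1 x
  gcongr

lemma mul_le_gaussianReal_one {θ c : ℝ} {S : Set ℝ} (hSm : MeasurableSet S)
    (hS : ∀ x ∈ S, θ * c ≤ θ * x) :
    ENNReal.ofReal (exp (θ * c - θ ^ 2 / 2)) * gaussianReal 0 1 S ≤ gaussianReal θ 1 S := by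
  rw [gaussianReal_apply _ one_ne_zero, gaussianReal_apply _ one_ne_zero,
    ← lintegral_const_mul _ (measurable_gaussianPDF 0 1)]
  refine setLIntegral_mono' hSm fun x hx ↦ ?_
  rw [gaussianPDF, gaussianPDF, ← ENNReal.ofReal_mul (exp_pos _).le,
    gaussianPDFReal_one_eq_exp_mul θ x]
  have := hS x hx
  have := gaussianPDFReal_nonneg 0 1 x
  gcongr

/-- The half-line `{x | θ * c ≤ θ * x}` minimises `N(0,1)`-probability among the measurable sets
with at least its `N(θ,1)`-probability. -/
lemma gaussianReal_zero_halfLine_le (θ c : ℝ) {A : Set ℝ} (hA : MeasurableSet A)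
    (h : gaussianReal θ 1 {x | θ * c ≤ θ * x} ≤ gaussianReal θ 1 A) :
    gaussianReal 0 1 {x | θ * c ≤ θ * x} ≤ gaussianReal 0 1 A := by
  have hB : MeasurableSet {x | θ * c ≤ θ * x} :=
    measurableSet_le measurable_const (measurable_const_mul θ)
  refine measure_le_of_likelihood_ratio (k := ENNReal.ofReal (exp (θ * c - θ ^ 2 / 2)))
    (by simp [exp_pos]) ENNReal.ofReal_ne_top hA hB
    (gaussianReal_one_le_mul (hA.diff hB) fun x hx ↦ (not_le.1 hx.2).le)
    (mul_le_gaussianReal_one (hB.diff hA) fun x hx ↦ hx.1) h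

lemma phi_eq_gaussianPDFReal : phi = gaussianPDFReal 0 1 := by
  ext x
  simp [phi, gaussianPDFReal]

lemma gaussianReal_zero_one_Iic (z : ℝ) :
    gaussianReal 0 1 (Iic z) = ENNReal.ofReal (Phi z) := by
  rw [gaussianReal_apply_eq_integral _ one_ne_zero, Phi, phi_eq_gaussianPDFReal]

lemma gaussianReal_one_Iic_add (θ z : ℝ) :
    gaussianReal θ 1 (Iic (θ + z)) = ENNReal.ofReal (Phi z) := by
  have h := gaussianReal_map_const_add (μ := 0) (v := 1) θ
  rw [zero_add] at h
  rw [← h, Measure.map_apply (by fun_prop) measurableSet_Iic, ← gaussianReal_zero_one_Iic]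
  congr 1
  ext x
  simp

lemma gaussianReal_one_Ici_sub (θ z : ℝ) :
    gaussianReal θ 1 (Ici (θ - z)) = ENNReal.ofReal (Phi z) := by
  have h := gaussianReal_map_const_sub (μ := 0) (v := 1) θ
  rw [sub_zero] at h
  rw [← h, Measure.map_apply (by fun_prop) measurableSet_Ici, ← gaussianReal_zero_one_Iic]
  congr 1
  ext x
  simp

/-- Pratt's interval, with the half-width `z` as a parameter. -/
def prattInterval (z x : ℝ) : Set ℝ := Icc (min 0 (x - z)) (max 0 (x + z))

lemma measurableSet_prattInterval (z : ℝ) :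
    MeasurableSet {p : ℝ × ℝ | p.2 ∈ prattInterval z p.1} :=
  (measurableSet_le (f := fun p : ℝ × ℝ ↦ min 0 (p.1 - z)) (by fun_prop) measurable_snd).inter
    (measurableSet_le (g := fun p : ℝ × ℝ ↦ max 0 (p.1 + z)) measurable_snd (by fun_prop))

lemma setOf_mem_prattInterval_of_pos {θ : ℝ} (hθ : 0 < θ) (z : ℝ) :
    {x | θ ∈ prattInterval z x} = Ici (θ - z) := by
  ext x
  simp [prattInterval, hθ.le, hθ.not_ge]

lemma setOf_mem_prattInterval_of_neg {θ : ℝ} (hθ : θ < 0) (z : ℝ) :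
    {x | θ ∈ prattInterval z x} = Iic (θ + z) := by
  ext x
  simp [prattInterval, hθ.le, hθ.not_ge]

/-- For `θ ≠ 0`, Pratt's interval has the smallest `N(0,1)`-probability of containing `θ` subject to
its coverage probability at `θ`. -/
lemma gaussianReal_zero_mem_prattInterval_le {θ : ℝ} (hθ : θ ≠ 0) (z : ℝ) {A : Set ℝ}
    (hA : MeasurableSet A) (h : ENNReal.ofReal (Phi z) ≤ gaussianReal θ 1 A) :
    gaussianReal 0 1 {x | θ ∈ prattInterval z x} ≤ gaussianReal 0 1 A := by
  rcases lt_or_gt_of_ne hθ with hθ | hθ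
  · have hset : {x | θ * (θ + z) ≤ θ * x} = Iic (θ + z) := by
      ext x
      exact mul_le_mul_left_of_neg hθ
    rw [setOf_mem_prattInterval_of_neg hθ, ← hset]
    refine gaussianReal_zero_halfLine_le θ (θ + z) hA ?_
    rwa [hset, gaussianReal_one_Iic_add]
  · have hset : {x | θ * (θ - z) ≤ θ * x} = Ici (θ - z) := by
      ext x
      exact mul_le_mul_iff_right₀ hθ
    rw [setOf_mem_prattInterval_of_pos hθ, ← hset]
    refine gaussianReal_zero_halfLine_le θ (θ - z) hA ?_
    rwa [hset, gaussianReal_one_Ici_sub]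

/-- The expected volume of a random set is the integral of its coverage probabilities. -/
lemma lintegral_volume_eq_lintegral_measure_mem (P : Measure ℝ) [SFinite P] {C : ℝ → Set ℝ}
    (hC : MeasurableSet {p : ℝ × ℝ | p.2 ∈ C p.1}) :
    ∫⁻ x, volume (C x) ∂P = ∫⁻ θ, P {x | θ ∈ C x} :=
  (Measure.prod_apply hC).symm.trans (Measure.prod_apply_symm hC)

lemma ofReal_integral_prattLength_le (z : ℝ) :
    ENNReal.ofReal (∫ x, (max 0 (x + z) - min 0 (x - z)) * phi x) ≤
      ∫⁻ x, volume (prattInterval z x) ∂(gaussianReal 0 1) := by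
  have hlen (x : ℝ) : 0 ≤ max 0 (x + z) - min 0 (x - z) :=
    sub_nonneg.2 ((min_le_left _ _).trans (le_max_left _ _))
  have hvol : ∫⁻ x, volume (prattInterval z x) ∂(gaussianReal 0 1) =
      ∫⁻ x, ENNReal.ofReal ((max 0 (x + z) - min 0 (x - z)) * phi x) := by
    simp only [prattInterval, Real.volume_Icc]
    rw [gaussianReal_of_var_ne_zero _ one_ne_zero,
      lintegral_withDensity_eq_lintegral_mul _ (measurable_gaussianPDF 0 1) (by fun_prop)]
    refine lintegral_congr fun x ↦ ?_
    rw [Pi.mul_apply, mul_comm, gaussianPDF, ENNReal.ofReal_mul (hlen x), phi_eq_gaussianPDFReal]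
  rw [hvol]
  by_cases hint : Integrable fun x ↦ (max 0 (x + z) - min 0 (x - z)) * phi x
  · refine (ofReal_integral_eq_lintegral_ofReal hint (ae_of_all _ fun x ↦ ?_)).le
    rw [phi_eq_gaussianPDFReal]
    exact mul_nonneg (hlen x) (gaussianPDFReal_nonneg 0 1 x)
  · simp [integral_undef hint]

/-- let `0 < α < 1/2` and `z = z_α` be the upper-`α` quantile of `N(0,1)`
(`Φ(z_α) = 1 − α`).  Suppose `C` assigns to each `x ∈ ℝ` a set `C(x) ⊆ ℝ`, with
`{(x, θ) : θ ∈ C(x)}` measurable, and `C` is a `1 − α` confidence procedure: for every `θ`,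
the `N(θ,1)` probability that `θ ∈ C(X)` is at least `1 − α`.  Then the expected Lebesgue
measure of `C(X)` under `X ∼ N(0,1)` is at least the expected length of Pratt's interval
at `θ = 0`. -/
theorem stmt_10 (α z : ℝ) (hα : 0 < α) (hα2 : α < 1 / 2) (hz : Phi z = 1 - α)
    (C : ℝ → Set ℝ) (hmeas : MeasurableSet {p : ℝ × ℝ | p.2 ∈ C p.1})
    (hcov : ∀ θ : ℝ, ENNReal.ofReal (1 - α) ≤ gaussianReal θ 1 {x : ℝ | θ ∈ C x}) :
    ENNReal.ofReal (∫ x, (max 0 (x + z) - min 0 (x - z)) * phi x) ≤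
      ∫⁻ x, volume (C x) ∂(gaussianReal 0 1) := by
  refine (ofReal_integral_prattLength_le z).trans ?_
  rw [lintegral_volume_eq_lintegral_measure_mem _ (measurableSet_prattInterval z),
    lintegral_volume_eq_lintegral_measure_mem _ hmeas]
  refine lintegral_mono_ae ?_
  filter_upwards [Measure.ae_ne volume 0] with θ hθ
  refine gaussianReal_zero_mem_prattInterval_le hθ z (measurable_prodMk_right hmeas) ?_
  rw [hz]
  exact hcov θ
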